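/- arXiv:2411.06195 — 3 statements merged into one kernel-verified Lean document; each statement's English description precedes it below -/
import Mathlib

section
/- Let W > 0 and X_W ~ IG(1/W, 1). Then E[log X_W] = −log W − ∫₀^∞ e^{−u}/(u + 2W) du. -/
open MeasureTheory Set

/-- Density of the inverse Gaussian distribution IG(μ, λ). -/
noncomputable def igPdf (μ lam x : ℝ) : ℝ :=
  Real.sqrt (lam / (2 * Real.pi * x ^ 3)) *
    Real.exp (-(lam * (x - μ) ^ 2) / (2 * μ ^ 2 * x))

open scoped ENNReal

theorem abs_arsinh_le_abs (x : ℝ) : |Real.arsinh x| ≤ |x| := by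
  have nonneg_case : ∀ y : ℝ, 0 ≤ y → |Real.arsinh y| ≤ |y| := fun y hy => by
    have h := Real.arsinh_nonneg_iff.2 hy
    rw [abs_of_nonneg h, abs_of_nonneg hy]
    simpa using Real.self_le_sinh_iff.2 h
  rcases le_total 0 x with hx | hx
  · exact nonneg_case x hx
  · simpa using nonneg_case (-x) (by linarith)

theorem abs_div_sqrt_one_add_sq_le_one (x : ℝ) : |x / √(1 + x ^ 2)| ≤ 1 := by
  rw [← Real.tanh_arsinh]
  exact (Real.abs_tanh_lt_one _).le

theorem continuous_inv_sqrt_one_add_sq : Continuous fun x : ℝ => (√(1 + x ^ 2))⁻¹ :=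
  Continuous.inv₀ (by fun_prop) fun x => (by positivity)

theorem lintegral_inv_sqrt_one_add_sq {x : ℝ} (hx : 0 ≤ x) :
    ∫⁻ s in Ioo 0 x, ENNReal.ofReal (√(1 + s ^ 2))⁻¹ = ENNReal.ofReal (Real.arsinh x) := by
  have hi := continuous_inv_sqrt_one_add_sq.intervalIntegrable (μ := volume) 0 x
  have h := intervalIntegral.integral_eq_sub_of_hasDerivAt
    (fun s _ => Real.hasDerivAt_arsinh s) hi
  rw [intervalIntegral.integral_of_le hx, Real.arsinh_zero, sub_zero] at h
  rw [restrict_Ioo_eq_restrict_Ioc, ← h]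
  exact (ofReal_integral_eq_lintegral_ofReal
    ((intervalIntegrable_iff_integrableOn_Ioc_of_le hx).1 hi)
    (ae_of_all _ fun s => by positivity)).symm

theorem lintegral_triangle_swap {f g : ℝ → ℝ≥0∞} (hf : Measurable f) (hg : Measurable g) :
    ∫⁻ x in Ioi 0, f x * ∫⁻ s in Ioo 0 x, g s = ∫⁻ s in Ioi 0, g s * ∫⁻ x in Ioi s, f x := by
  let F : ℝ → ℝ → ℝ≥0∞ := fun x s =>
    {p : ℝ × ℝ | 0 < p.2 ∧ p.2 < p.1}.indicator (fun p => f p.1 * g p.2) (x, s)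
  have hF : Measurable (Function.uncurry F) := by
    refine Measurable.indicator (by fun_prop) ?_
    exact (measurableSet_lt measurable_const measurable_snd).inter
      (measurableSet_lt measurable_snd measurable_fst)
  have hl : ∫⁻ x in Ioi 0, f x * ∫⁻ s in Ioo 0 x, g s = ∫⁻ x, ∫⁻ s, F x s := by
    rw [← lintegral_indicator measurableSet_Ioi]
    refine lintegral_congr fun x => ?_
    have : ∀ s, F x s = (Ioo 0 x).indicator (fun s => f x * g s) s := fun s => rfl
    simp_rw [this]
    rw [lintegral_indicator measurableSet_Ioo, lintegral_const_mul _ hg]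
    by_cases hx : 0 < x
    · simp [hx]
    · simp [hx]
  have hr : ∫⁻ s in Ioi 0, g s * ∫⁻ x in Ioi s, f x = ∫⁻ s, ∫⁻ x, F x s := by
    rw [← lintegral_indicator measurableSet_Ioi]
    refine lintegral_congr fun s => ?_
    by_cases hs : 0 < s
    · have : ∀ x, F x s = (Ioi s).indicator (fun x => g s * f x) x := fun x => by
        simp [F, indicator_apply, hs, mul_comm]
      simp_rw [this]
      rw [lintegral_indicator measurableSet_Ioi, lintegral_const_mul _ hf]
      simp [hs]
    · simp [F, hs]
  rw [hl, hr, lintegral_lintegral_swap hF.aemeasurable]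

/-- The substitution `x ^ 2 = p + s ^ 2 * (1 + p)`, i.e. `1 + x ^ 2 = (1 + p) * (1 + s ^ 2)`. -/
theorem lintegral_Ioi_substitution {a s : ℝ} (hs : 0 < s) :
    ENNReal.ofReal (√(1 + s ^ 2))⁻¹ *
        ∫⁻ x in Ioi s, ENNReal.ofReal (2 * x / √(1 + x ^ 2) * Real.exp (-a * x ^ 2)) =
      ∫⁻ p in Ioi 0, ENNReal.ofReal
        (Real.exp (-a * p) / √(1 + p) * Real.exp (-(a * (1 + p)) * s ^ 2)) := by
  let φ : ℝ → ℝ := fun p => √(p + s ^ 2 * (1 + p))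
  have hpos : ∀ p ∈ Ioi (0 : ℝ), 0 < p + s ^ 2 * (1 + p) := fun p hp => by
    have : 0 < p := hp
    positivity
  have himg : φ '' Ioi 0 = Ioi s := by
    ext x
    constructor
    · rintro ⟨p, hp, rfl⟩
      have : 0 < p := hp
      exact Real.lt_sqrt_of_sq_lt (by nlinarith [sq_nonneg s])
    · intro hx
      have hx : s < x := hx
      refine ⟨(x ^ 2 - s ^ 2) / (1 + s ^ 2), ?_, ?_⟩
      · have : 0 < x ^ 2 - s ^ 2 := by nlinarith
        exact div_pos this (by positivity)
      · have : (x ^ 2 - s ^ 2) / (1 + s ^ 2) + s ^ 2 * (1 + (x ^ 2 - s ^ 2) / (1 + s ^ 2))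
            = x ^ 2 := by field_simp; ring
        simp only [φ, this]
        exact Real.sqrt_sq (by linarith)
  have hderiv : ∀ p ∈ Ioi (0 : ℝ),
      HasDerivWithinAt φ ((1 + s ^ 2) / (2 * φ p)) (Ioi 0) p := fun p hp => by
    have h : HasDerivAt (fun p : ℝ => p + s ^ 2 * (1 + p)) (1 + s ^ 2) p := by
      simpa using (hasDerivAt_id' p).fun_add (((hasDerivAt_id' p).const_add 1).const_mul (s ^ 2))
    exact (h.sqrt (hpos p hp).ne').hasDerivWithinAt
  have hinj : InjOn φ (Ioi 0) := fun p hp q hq h => by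
    have := (Real.sqrt_inj (hpos p hp).le (hpos q hq).le).1 h
    nlinarith [sq_nonneg s]
  rw [← himg, lintegral_image_eq_lintegral_abs_deriv_mul measurableSet_Ioi hderiv hinj,
    ← lintegral_const_mul' _ _ ENNReal.ofReal_ne_top]
  refine setLIntegral_congr_fun measurableSet_Ioi fun p hp => ?_
  have hp0 : 0 < p := hp
  have hφ : 0 < φ p := Real.sqrt_pos.2 (hpos p hp)
  have hsq : φ p ^ 2 = p + s ^ 2 * (1 + p) := Real.sq_sqrt (hpos p hp).le
  have hfac : √(1 + φ p ^ 2) = √(1 + p) * √(1 + s ^ 2) := by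
    rw [← Real.sqrt_mul (by linarith), hsq]
    ring_nf
  have hS : √(1 + s ^ 2) ^ 2 = 1 + s ^ 2 := Real.sq_sqrt (by positivity)
  have hexp : Real.exp (-a * φ p ^ 2) =
      Real.exp (-a * p) * Real.exp (-(a * (1 + p)) * s ^ 2) := by
    rw [← Real.exp_add, hsq]
    ring_nf
  rw [← ENNReal.ofReal_mul (by positivity), ← ENNReal.ofReal_mul (by positivity)]
  congr 1
  rw [abs_of_nonneg (by positivity), hfac, hexp]
  have : 0 < √(1 + p) := by positivity
  have : 0 < √(1 + s ^ 2) := by positivity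
  field_simp
  linear_combination -hS

theorem lintegral_arsinh_mul_exp_neg_mul_sq {a : ℝ} (ha : 0 < a) :
    ∫⁻ x in Ioi 0, ENNReal.ofReal
        (2 * (x / √(1 + x ^ 2) * Real.arsinh x * Real.exp (-a * x ^ 2))) =
      ∫⁻ p in Ioi 0, ENNReal.ofReal (√(Real.pi / a) / 2 * (Real.exp (-a * p) / (1 + p))) := by
  calc
    _ = ∫⁻ x in Ioi 0, ENNReal.ofReal (2 * x / √(1 + x ^ 2) * Real.exp (-a * x ^ 2)) *
          ∫⁻ s in Ioo 0 x, ENNReal.ofReal (√(1 + s ^ 2))⁻¹ := by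
      refine setLIntegral_congr_fun measurableSet_Ioi fun x hx => ?_
      have hx : 0 < x := hx
      rw [lintegral_inv_sqrt_one_add_sq hx.le, ← ENNReal.ofReal_mul (by positivity)]
      ring_nf
    _ = ∫⁻ s in Ioi 0, ∫⁻ p in Ioi 0, ENNReal.ofReal
          (Real.exp (-a * p) / √(1 + p) * Real.exp (-(a * (1 + p)) * s ^ 2)) := by
      rw [lintegral_triangle_swap (by fun_prop) (by fun_prop)]
      exact setLIntegral_congr_fun measurableSet_Ioi fun s hs => lintegral_Ioi_substitution hs
    _ = ∫⁻ p in Ioi 0, ∫⁻ s in Ioi 0, ENNReal.ofReal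
          (Real.exp (-a * p) / √(1 + p) * Real.exp (-(a * (1 + p)) * s ^ 2)) :=
      lintegral_lintegral_swap (Measurable.aemeasurable (by fun_prop))
    _ = _ := by
      refine setLIntegral_congr_fun measurableSet_Ioi fun p hp => ?_
      have hp : 0 < p := hp
      have hb : 0 < a * (1 + p) := by positivity
      rw [← ofReal_integral_eq_lintegral_ofReal
        ((integrable_exp_neg_mul_sq hb).integrableOn.const_mul _)
        (ae_of_all _ fun s => by positivity), integral_const_mul, integral_gaussian_Ioi,
        ← div_div, Real.sqrt_div' _ (by positivity)]
      congr 1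
      have hS : √(1 + p) ^ 2 = 1 + p := Real.sq_sqrt (by positivity)
      have : 0 < √(1 + p) := by positivity
      field_simp
      rw [hS]

theorem integral_arsinh_mul_exp_neg_mul_sq {a : ℝ} (ha : 0 < a) :
    ∫ x, x / √(1 + x ^ 2) * Real.arsinh x * Real.exp (-a * x ^ 2) =
      √(Real.pi / a) / 2 * ∫ u in Ioi 0, Real.exp (-u) / (u + a) := by
  have habs : ∀ x : ℝ, x / √(1 + x ^ 2) * Real.arsinh x * Real.exp (-a * x ^ 2) =
      |x| / √(1 + |x| ^ 2) * Real.arsinh |x| * Real.exp (-a * |x| ^ 2) := fun x => by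
    rcases abs_cases x with ⟨h, _⟩ | ⟨h, _⟩ <;> simp [h, neg_div]
  rw [integral_congr_ae (ae_of_all _ habs), integral_comp_abs (f := fun x => x / √(1 + x ^ 2) * Real.arsinh x * Real.exp (-a * x ^ 2)),
    ← integral_const_mul, integral_eq_lintegral_of_nonneg_ae, lintegral_arsinh_mul_exp_neg_mul_sq ha,
    ← integral_eq_lintegral_of_nonneg_ae, integral_const_mul]
  · congr 1
    have h := integral_comp_mul_left_Ioi' (fun u => Real.exp (-u) / (u + a)) 0 ha
    rw [mul_zero] at h
    rw [← h, smul_eq_mul, ← integral_const_mul]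
    refine setIntegral_congr_fun measurableSet_Ioi fun p hp => ?_
    have hp : 0 < p := hp
    field_simp
    ring_nf
  · filter_upwards [self_mem_ae_restrict measurableSet_Ioi] with p hp
    have hp : 0 < p := hp
    simp only [Pi.zero_apply]
    positivity
  · exact Measurable.aestronglyMeasurable (by fun_prop)
  · filter_upwards [self_mem_ae_restrict measurableSet_Ioi] with x hx
    have hx : 0 < x := hx
    have := Real.arsinh_pos_iff.2 hx
    simp only [Pi.zero_apply]
    positivity
  · have := Real.continuous_arsinh.measurable
    exact Measurable.aestronglyMeasurable (by fun_prop)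

/-- Odd functions have zero integral. -/
theorem integral_eq_zero_of_neg {f : ℝ → ℝ} (hf : ∀ x, f (-x) = -f x) : ∫ x, f x = 0 := by
  have h := integral_neg_eq_self f volume
  simp_rw [hf, integral_neg] at h
  linarith

theorem igPdf_inv_one_exp_arsinh {W : ℝ} (hW : 0 < W) (s : ℝ) :
    2 / √(1 + s ^ 2) * (Real.exp (2 * Real.arsinh s) / W) *
        igPdf W⁻¹ 1 (Real.exp (2 * Real.arsinh s) / W) =
      2 * √(W / (2 * Real.pi)) *
        ((1 - s / √(1 + s ^ 2)) * Real.exp (-(2 * W) * s ^ 2)) := by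
  set r := √(1 + s ^ 2) with hr
  have hr0 : 0 < r := by positivity
  have hr2 : r ^ 2 = 1 + s ^ 2 := Real.sq_sqrt (by positivity)
  set E := Real.exp (Real.arsinh s) with hE
  have hE0 : 0 < E := Real.exp_pos _
  have hEr : E = s + r := Real.exp_arsinh s
  have hEinv : E * (r - s) = 1 := by rw [hEr]; linear_combination hr2
  have hE2 : Real.exp (2 * Real.arsinh s) = E ^ 2 := by
    rw [hE, ← Real.exp_nat_mul]; norm_num
  have hexp : -(1 * (E ^ 2 / W - W⁻¹) ^ 2) / (2 * W⁻¹ ^ 2 * (E ^ 2 / W)) = -(2 * W) * s ^ 2 := by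
    have : E ^ 2 - 1 = 2 * s * E := by
      rw [← hEinv, hEr]; ring
    have h : E ^ 2 / W - W⁻¹ = 2 * s * E / W := by rw [← this]; field_simp
    rw [h]
    field_simp
  have hsqrt : √(1 / (2 * Real.pi * (E ^ 2 / W) ^ 3)) = √(W / (2 * Real.pi)) * (W / E ^ 3) := by
    rw [← Real.sqrt_sq (by positivity : 0 ≤ W / E ^ 3), ← Real.sqrt_mul (by positivity)]
    congr 1
    field_simp
  rw [igPdf, hE2, hexp, hsqrt]
  field_simp
  linear_combination -hEinv

theorem integral_comp_exp_arsinh {W : ℝ} (hW : 0 < W) (g : ℝ → ℝ) :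
    ∫ x in Ioi 0, g x = ∫ s, 2 / √(1 + s ^ 2) * (Real.exp (2 * Real.arsinh s) / W) *
      g (Real.exp (2 * Real.arsinh s) / W) := by
  let φ : ℝ → ℝ := fun s => Real.exp (2 * Real.arsinh s) / W
  have himg : φ '' univ = Ioi 0 := by
    ext x
    simp only [image_univ, mem_range, mem_Ioi]
    constructor
    · rintro ⟨s, rfl⟩
      positivity
    · intro hx
      refine ⟨Real.sinh (Real.log (W * x) / 2), ?_⟩
      simp only [φ, Real.arsinh_sinh]
      rw [mul_div_cancel₀ _ two_ne_zero, Real.exp_log (by positivity)]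
      field_simp
  have hderiv : ∀ s ∈ (univ : Set ℝ),
      HasDerivWithinAt φ (2 / √(1 + s ^ 2) * (Real.exp (2 * Real.arsinh s) / W)) univ s :=
    fun s _ => by
      have h := (((Real.hasDerivAt_arsinh s).const_mul 2).exp.div_const W).hasDerivWithinAt
        (s := univ)
      exact h.congr_deriv (by ring)
  have hinj : InjOn φ univ := fun s _ t _ h => by
    have h : Real.exp (2 * Real.arsinh s) / W = Real.exp (2 * Real.arsinh t) / W := h
    rw [div_left_inj' hW.ne', Real.exp_eq_exp] at h
    exact Real.arsinh_injective (by linarith)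
  rw [← himg, integral_image_eq_integral_abs_deriv_smul MeasurableSet.univ hderiv hinj,
    setIntegral_univ]
  refine integral_congr_ae (ae_of_all _ fun s => ?_)
  simp only [smul_eq_mul]
  rw [abs_of_nonneg (by positivity)]

theorem ig_log_moment (W : ℝ) (hW : 0 < W) :
    ∫ x in Ioi (0 : ℝ), Real.log x * igPdf W⁻¹ 1 x
      = -Real.log W - ∫ u in Ioi (0 : ℝ), Real.exp (-u) / (u + 2 * W) := by
  have ha : 0 < 2 * W := by positivity
  set C := √(W / (2 * Real.pi)) with hC
  have hCπ : C * √(Real.pi / (2 * W)) = 1 / 2 := by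
    rw [hC, ← Real.sqrt_mul (by positivity),
      show W / (2 * Real.pi) * (Real.pi / (2 * W)) = (1 / 2) ^ 2 by field_simp]
    exact Real.sqrt_sq (by norm_num)
  let e : ℝ → ℝ := fun s => Real.exp (-(2 * W) * s ^ 2)
  let q : ℝ → ℝ := fun s => s / √(1 + s ^ 2)
  have he : Integrable e := integrable_exp_neg_mul_sq ha
  have hse : Integrable fun s => s * e s := integrable_mul_exp_neg_mul_sq ha
  have hqm : Continuous q := continuous_id.mul continuous_inv_sqrt_one_add_sq
  have hAe : Integrable fun s => Real.arsinh s * e s :=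
    hse.mono (by have := Real.continuous_arsinh; exact Continuous.aestronglyMeasurable (by fun_prop))
      (ae_of_all _ fun s => by
        simp only [norm_mul, Real.norm_eq_abs]
        exact mul_le_mul_of_nonneg_right (abs_arsinh_le_abs s) (abs_nonneg _))
  have hqAe : Integrable fun s => q s * (Real.arsinh s * e s) :=
    hAe.bdd_mul hqm.aestronglyMeasurable (ae_of_all _ abs_div_sqrt_one_add_sq_le_one)
  have hqe : Integrable fun s => q s * e s :=
    he.bdd_mul hqm.aestronglyMeasurable (ae_of_all _ abs_div_sqrt_one_add_sq_le_one)
  have hodd : ∫ s, (2 * (Real.arsinh s * e s) + Real.log W * (q s * e s)) = 0 :=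
    integral_eq_zero_of_neg fun s => by simp [e, q, neg_div]; ring
  have hqAe_val : ∫ s, q s * (Real.arsinh s * e s) =
      √(Real.pi / (2 * W)) / 2 * ∫ u in Ioi 0, Real.exp (-u) / (u + 2 * W) := by
    rw [← integral_arsinh_mul_exp_neg_mul_sq ha]
    simp only [q, e, mul_assoc]
  have he_val : ∫ s, e s = √(Real.pi / (2 * W)) := integral_gaussian _
  calc
    _ = ∫ s, 2 * C * ((2 * (Real.arsinh s * e s) + Real.log W * (q s * e s)) -
          Real.log W * e s - 2 * (q s * (Real.arsinh s * e s))) := by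
      rw [integral_comp_exp_arsinh hW]
      refine integral_congr_ae (ae_of_all _ fun s => ?_)
      simp only
      rw [mul_left_comm, igPdf_inv_one_exp_arsinh hW,
        Real.log_div (Real.exp_ne_zero _) hW.ne', Real.log_exp]
      simp only [q, e]
      ring
    _ = _ := by
      have hodd_int := (hAe.const_mul 2).fun_add (hqe.const_mul (Real.log W))
      have he_int := he.const_mul (Real.log W)
      have hsub_int : Integrable fun s => 2 * (Real.arsinh s * e s) + Real.log W * (q s * e s) -
          Real.log W * e s := hodd_int.sub he_int
      rw [integral_const_mul, integral_sub hsub_int (hqAe.const_mul 2),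
        integral_sub hodd_int he_int, hodd,
        integral_const_mul, integral_const_mul, hqAe_val, he_val]
      linear_combination (-2 * Real.log W -
        2 * ∫ u in Ioi 0, Real.exp (-u) / (u + 2 * W)) * hCπ
end

section
/- Let W > 0 and X_W ~ IG(1/W, 1). Then −log(W + 1/2) ≤ E[log X_W] ≤ min{−log W, c₂}, where c₂ = γ + log 2 and γ is the Euler–Mascheroni constant. -/
open MeasureTheory Set

/-- The Euler–Mascheroni constant, γ = -∫₀^∞ e^{-t} log t dt. -/
noncomputable def gammaEM : ℝ := -∫ t in Ioi (0 : ℝ), Real.exp (-t) * Real.log t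

/-- The constant c₂ = γ + log 2. -/
noncomputable def cTwo : ℝ := gammaEM + Real.log 2

section InverseGaussian

open Real Filter Topology

/-- Density of the Lévy distribution with unit scale, the limit of `igPdf μ 1` as `μ → ∞`. -/
noncomputable def levyPdf (x : ℝ) : ℝ :=
  (√(2 * π))⁻¹ * x ^ (-(3 / 2) : ℝ) * exp (-(2 * x)⁻¹)

/-- The integral of `g` against the density of the inverse Gaussian distribution `IG(1/W, 1)`. -/
noncomputable def igMoment (g : ℝ → ℝ) (W : ℝ) : ℝ :=
  ∫ x in Ioi (0 : ℝ), g x * (exp (W - W ^ 2 * x / 2) * levyPdf x)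

lemma levyPdf_nonneg {x : ℝ} (hx : 0 < x) : 0 ≤ levyPdf x := by
  unfold levyPdf; positivity

lemma measurable_levyPdf : Measurable levyPdf := by
  unfold levyPdf; fun_prop

lemma igPdf_inv_one {W x : ℝ} (hW : 0 < W) (hx : 0 < x) :
    igPdf W⁻¹ 1 x = exp (W - W ^ 2 * x / 2) * levyPdf x := by
  have h1 : √(1 / (2 * π * x ^ 3)) = (√(2 * π))⁻¹ * x ^ (-(3 / 2) : ℝ) := by
    rw [one_div, sqrt_inv, sqrt_mul (by positivity), mul_inv, sqrt_eq_rpow (x ^ 3),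
      ← rpow_natCast, ← rpow_mul hx.le, rpow_neg hx.le]
    norm_num
  have h2 : -(1 * (x - W⁻¹) ^ 2) / (2 * W⁻¹ ^ 2 * x) = (W - W ^ 2 * x / 2) + -(2 * x)⁻¹ := by
    field_simp
    ring
  rw [igPdf, levyPdf, h1, h2, exp_add]
  ring

lemma image_inv_mul_Ioi {c : ℝ} (hc : 0 < c) :
    (fun x : ℝ ↦ (c * x)⁻¹) '' Ioi 0 = Ioi 0 := by
  ext y
  constructor
  · rintro ⟨x, hx, rfl⟩
    have : 0 < x := hx
    exact mem_Ioi.2 (by positivity)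
  · intro hy
    have : 0 < y := hy
    exact ⟨(c * y)⁻¹, mem_Ioi.2 (by positivity), by field_simp⟩

lemma hasDerivAt_inv_mul {c x : ℝ} (hc : 0 < c) (hx : 0 < x) :
    HasDerivAt (fun x : ℝ ↦ (c * x)⁻¹) (-(c * x ^ 2)⁻¹) x := by
  have h := ((hasDerivAt_id x).const_mul c).fun_inv (by simp; exact ⟨hc.ne', hx.ne'⟩)
  refine h.congr_deriv ?_
  simp only [id]
  field_simp

lemma injOn_inv_mul {c : ℝ} (hc : 0 < c) : InjOn (fun x : ℝ ↦ (c * x)⁻¹) (Ioi 0) := by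
  intro x _ y _ h
  simpa [hc.ne'] using h

lemma integral_Ioi_comp_inv_mul {c : ℝ} (hc : 0 < c) (F : ℝ → ℝ) :
    ∫ x in Ioi (0 : ℝ), F x = ∫ x in Ioi (0 : ℝ), (c * x ^ 2)⁻¹ * F (c * x)⁻¹ := by
  have h := integral_image_eq_integral_abs_deriv_smul measurableSet_Ioi
    (fun x hx ↦ (hasDerivAt_inv_mul hc hx).hasDerivWithinAt) (injOn_inv_mul hc) F
  rw [image_inv_mul_Ioi hc] at h
  rw [h]
  refine setIntegral_congr_fun measurableSet_Ioi fun x _ ↦ ?_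
  simp only [smul_eq_mul, abs_neg]
  rw [abs_of_nonneg (by positivity)]

lemma integrableOn_Ioi_comp_inv_mul {c : ℝ} (hc : 0 < c) {F : ℝ → ℝ}
    (hF : IntegrableOn (fun x ↦ (c * x ^ 2)⁻¹ * F (c * x)⁻¹) (Ioi 0)) :
    IntegrableOn F (Ioi 0) := by
  rw [← image_inv_mul_Ioi hc, integrableOn_image_iff_integrableOn_abs_deriv_smul measurableSet_Ioi
    (fun x hx ↦ (hasDerivAt_inv_mul hc hx).hasDerivWithinAt) (injOn_inv_mul hc)]
  refine hF.congr_fun (fun x _ ↦ ?_) measurableSet_Ioi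
  simp only [smul_eq_mul, abs_neg]
  rw [abs_of_nonneg (by positivity)]

lemma levyPdf_inv_two_mul {y : ℝ} (hy : 0 < y) :
    (2 * y ^ 2)⁻¹ * levyPdf (2 * y)⁻¹ = (√π)⁻¹ * (y ^ (1 / 2 - 1 : ℝ) * exp (-y)) := by
  have h1 : ((2 * y)⁻¹ : ℝ) ^ (-(3 / 2) : ℝ) = √2 * 2 * (y ^ (1 / 2 - 1 : ℝ) * y ^ 2) := by
    rw [inv_rpow (by positivity), rpow_neg (by positivity), inv_inv, mul_rpow (by norm_num) hy.le,
      sqrt_eq_rpow, ← rpow_natCast, ← rpow_add hy, ← rpow_add_one (by norm_num)]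
    norm_num
  rw [levyPdf, h1, sqrt_mul (by norm_num)]
  have h2 : (2 * (2 * y)⁻¹)⁻¹ = y := by field_simp
  rw [h2]
  field_simp

lemma integral_mul_levyPdf (g : ℝ → ℝ) :
    ∫ x in Ioi (0 : ℝ), g x * levyPdf x =
      (√π)⁻¹ * ∫ y in Ioi (0 : ℝ), g (2 * y)⁻¹ * (y ^ (1 / 2 - 1 : ℝ) * exp (-y)) := by
  rw [integral_Ioi_comp_inv_mul two_pos, ← integral_const_mul]
  refine setIntegral_congr_fun measurableSet_Ioi fun y hy ↦ ?_
  have := levyPdf_inv_two_mul hy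
  linear_combination g (2 * y)⁻¹ * this

lemma integrableOn_rpow_mul_levyPdf {b : ℝ} (hb : b < 1 / 2) :
    IntegrableOn (fun x ↦ x ^ b * levyPdf x) (Ioi 0) := by
  refine integrableOn_Ioi_comp_inv_mul two_pos ?_
  have h := (GammaIntegral_convergent (s := 1 / 2 - b) (by linarith)).const_mul
    ((√π)⁻¹ * (2 ^ b)⁻¹)
  refine IntegrableOn.congr_fun h (fun y (hy : 0 < y) ↦ ?_) measurableSet_Ioi
  have h1 := levyPdf_inv_two_mul hy
  have h2 : ((2 * y)⁻¹ : ℝ) ^ b = (2 ^ b)⁻¹ * y ^ (-b) := by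
    rw [inv_rpow (by positivity), mul_rpow (by norm_num) hy.le, mul_inv, rpow_neg hy.le]
  have h3 : y ^ (1 / 2 - b - 1) = y ^ (1 / 2 - 1 : ℝ) * y ^ (-b) := by
    rw [← rpow_add hy]; ring_nf
  rw [h2, h3]
  linear_combination (-(2 ^ b)⁻¹ * y ^ (-b)) * h1

lemma one_add_abs_log_le {x : ℝ} (hx : 0 < x) :
    1 + |log x| ≤ 5 * (x ^ (1 / 4 : ℝ) + x ^ (-(1 / 4) : ℝ)) := by
  have h1 := log_le_rpow_div hx.le (ε := 1 / 4) (by norm_num)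
  have h2 := log_le_rpow_div (inv_pos.2 hx).le (ε := 1 / 4) (by norm_num)
  rw [log_inv, inv_rpow hx.le, ← rpow_neg hx.le] at h2
  have h3 : x ^ (1 / 4 : ℝ) * x ^ (-(1 / 4) : ℝ) = 1 := by
    rw [← rpow_add hx]; simp
  have h4 : 0 < x ^ (1 / 4 : ℝ) := by positivity
  have h5 : 0 < x ^ (-(1 / 4) : ℝ) := by positivity
  have h6 : 1 ≤ x ^ (1 / 4 : ℝ) + x ^ (-(1 / 4) : ℝ) := by
    nlinarith [sq_nonneg (x ^ (1 / 4 : ℝ) - x ^ (-(1 / 4) : ℝ))]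
  have h7 : |log x| ≤ 4 * (x ^ (1 / 4 : ℝ) + x ^ (-(1 / 4) : ℝ)) := by
    rw [abs_le]; constructor <;> linarith
  linarith

lemma integrableOn_one_add_abs_log_mul_levyPdf :
    IntegrableOn (fun x ↦ (1 + |log x|) * levyPdf x) (Ioi 0) := by
  have h := ((integrableOn_rpow_mul_levyPdf (b := 1 / 4) (by norm_num)).add
    (integrableOn_rpow_mul_levyPdf (b := -(1 / 4)) (by norm_num))).const_mul 5
  refine Integrable.mono' h ?_ ?_
  · exact ((measurable_const.add measurable_log.abs).mul measurable_levyPdf).aestronglyMeasurable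
  · filter_upwards [ae_restrict_mem measurableSet_Ioi] with x hx
    have hx : 0 < x := hx
    have h1 := levyPdf_nonneg hx
    rw [norm_of_nonneg (by positivity)]
    have := mul_le_mul_of_nonneg_right (one_add_abs_log_le hx) h1
    simp only [Pi.add_apply]
    linarith

lemma integral_rpow_mul_log_mul_exp_neg {s : ℝ} (hs : 0 < s) :
    ∫ t in Ioi (0 : ℝ), t ^ (s - 1) * (log t * exp (-t)) = deriv Gamma s := by
  have h1 : HasDerivAt Complex.Gamma
      (∫ t : ℝ in Ioi 0, (t : ℂ) ^ ((s : ℂ) - 1) * (log t * exp (-t))) s := by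
    refine (Complex.hasDerivAt_GammaIntegral (s := s) (by simpa using hs)).congr_of_eventuallyEq ?_
    have : {z : ℂ | 0 < z.re} ∈ 𝓝 (s : ℂ) :=
      (isOpen_lt continuous_const Complex.continuous_re).mem_nhds (by simpa using hs)
    filter_upwards [this] with z hz using Complex.Gamma_eq_integral hz
  have h2 : ∫ t : ℝ in Ioi 0, (t : ℂ) ^ ((s : ℂ) - 1) * (log t * exp (-t)) =
      ((∫ t in Ioi (0 : ℝ), t ^ (s - 1) * (log t * exp (-t)) : ℝ) : ℂ) := by
    rw [← integral_complex_ofReal]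
    refine setIntegral_congr_fun measurableSet_Ioi fun t (ht : 0 < t) ↦ ?_
    push_cast [Complex.ofReal_cpow ht.le]
    rfl
  rw [h2] at h1
  have h3 := h1.real_of_complex
  simp only [Complex.Gamma_ofReal, Complex.ofReal_re] at h3
  exact h3.deriv.symm

lemma gammaEM_eq : gammaEM = eulerMascheroniConstant := by
  have h := integral_rpow_mul_log_mul_exp_neg one_pos
  simp only [sub_self, rpow_zero, one_mul] at h
  rw [gammaEM, eulerMascheroniConstant_eq_neg_deriv, ← h]
  simp only [mul_comm]

lemma integral_levyPdf : ∫ x in Ioi (0 : ℝ), levyPdf x = 1 := by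
  have h := integral_mul_levyPdf fun _ ↦ 1
  have h2 := Gamma_eq_integral (s := 1 / 2) (by norm_num)
  simp only [one_mul] at h
  simp only [mul_comm (exp _), Gamma_one_half_eq] at h2
  rw [h, ← h2, inv_mul_cancel₀ (sqrt_ne_zero'.2 pi_pos)]

lemma integral_log_mul_levyPdf : ∫ x in Ioi (0 : ℝ), log x * levyPdf x = cTwo := by
  have h1 := integral_rpow_mul_log_mul_exp_neg (s := 1 / 2) (by norm_num)
  have h2 := Gamma_eq_integral (s := 1 / 2) (by norm_num)
  have hπ : √π ≠ 0 := sqrt_ne_zero'.2 pi_pos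
  have i1 : IntegrableOn (fun y : ℝ ↦ log 2 * (exp (-y) * y ^ (1 / 2 - 1 : ℝ))) (Ioi 0) :=
    (GammaIntegral_convergent (by norm_num)).const_mul _
  have hd := hasDerivAt_Gamma_one_half.deriv
  have i2 : IntegrableOn (fun t : ℝ ↦ t ^ (1 / 2 - 1 : ℝ) * (log t * exp (-t))) (Ioi 0) := by
    by_contra hn
    rw [integral_undef hn, hd] at h1
    have h3 := one_half_lt_eulerMascheroniConstant
    have h4 := log_pos one_lt_two
    have : 0 < √π * (eulerMascheroniConstant + 2 * log 2) := by positivity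
    linarith
  rw [integral_mul_levyPdf, cTwo, gammaEM_eq]
  have h3 : ∫ y in Ioi (0 : ℝ), log (2 * y)⁻¹ * (y ^ (1 / 2 - 1 : ℝ) * exp (-y)) =
      -(log 2 * √π + deriv Gamma (1 / 2)) := by
    rw [← Gamma_one_half_eq, h2, ← h1, ← integral_const_mul, ← integral_add i1 i2, ← integral_neg]
    refine setIntegral_congr_fun measurableSet_Ioi fun y (hy : 0 < y) ↦ ?_
    rw [log_inv, log_mul two_ne_zero hy.ne']
    ring
  rw [h3, hd]
  field_simp
  ring

section Moment

variable {g : ℝ → ℝ}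

lemma integrableOn_mul_igDensity (hg : Measurable g) (hgl : ∀ x, 0 < x → |g x| ≤ 1 + |log x|)
    (W : ℝ) : IntegrableOn (fun x ↦ g x * (exp (W - W ^ 2 * x / 2) * levyPdf x)) (Ioi 0) := by
  refine Integrable.mono' (integrableOn_one_add_abs_log_mul_levyPdf.const_mul (exp W)) ?_ ?_
  · exact (hg.mul (Measurable.mul (by fun_prop) measurable_levyPdf)).aestronglyMeasurable
  · filter_upwards [ae_restrict_mem measurableSet_Ioi] with x hx
    have hx : 0 < x := hx
    have h1 := levyPdf_nonneg hx
    rw [norm_mul, norm_eq_abs, norm_of_nonneg (by positivity)]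
    have h2 : exp (W - W ^ 2 * x / 2) ≤ exp W := exp_le_exp.2 (by
      have : 0 ≤ W ^ 2 * x / 2 := by positivity
      linarith)
    calc |g x| * (exp (W - W ^ 2 * x / 2) * levyPdf x)
        ≤ (1 + |log x|) * (exp W * levyPdf x) := by
          gcongr
          exact hgl x hx
      _ = _ := by ring

lemma integral_mul_mul_igDensity (g : ℝ → ℝ) {W : ℝ} (hW : 0 < W) :
    ∫ x in Ioi (0 : ℝ), g x * (W * x * (exp (W - W ^ 2 * x / 2) * levyPdf x)) =
      igMoment (fun x ↦ g (W ^ 2 * x)⁻¹) W := by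
  rw [integral_Ioi_comp_inv_mul (pow_pos hW 2), igMoment]
  refine setIntegral_congr_fun measurableSet_Ioi fun x (hx : 0 < x) ↦ ?_
  have h1 : ((W ^ 2 * x)⁻¹ : ℝ) ^ (-(3 / 2) : ℝ) = W ^ 3 * x ^ 3 * x ^ (-(3 / 2) : ℝ) := by
    rw [inv_rpow (by positivity), rpow_neg (by positivity), inv_inv, mul_rpow (by positivity) hx.le,
      ← rpow_natCast W 2, ← rpow_mul hW.le, ← rpow_natCast x 3, mul_assoc, ← rpow_add hx,
      ← rpow_natCast W 3]
    norm_num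
  have h2 : exp (W - W ^ 2 * (W ^ 2 * x)⁻¹ / 2) * exp (-(2 * (W ^ 2 * x)⁻¹)⁻¹) =
      exp (W - W ^ 2 * x / 2) * exp (-(2 * x)⁻¹) := by
    rw [← exp_add, ← exp_add]
    congr 1
    field_simp
    ring
  have h3 : (W ^ 2 * x ^ 2)⁻¹ * (W * (W ^ 2 * x)⁻¹) * (W ^ 3 * x ^ 3) = 1 := by field_simp
  simp only [levyPdf]
  rw [h1]
  linear_combination
    (g (W ^ 2 * x)⁻¹ * ((√(2 * π))⁻¹ * x ^ (-(3 / 2) : ℝ))) *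
      ((exp (W - W ^ 2 * (W ^ 2 * x)⁻¹ / 2) * exp (-(2 * (W ^ 2 * x)⁻¹)⁻¹)) * h3 + h2)

lemma abs_one_sub_mul_mul_exp_le {w x : ℝ} (hw : 0 < w) (hx : 0 < x) :
    |1 - w * x| * exp (w - w ^ 2 * x / 2) ≤ exp w * (1 + 2 / w) := by
  have h1 : |1 - w * x| ≤ 1 + w * x := by
    have := mul_pos hw hx
    rw [abs_le]; constructor <;> linarith
  have h2 : w ^ 2 * x / 2 ≤ exp (w ^ 2 * x / 2) := by linarith [add_one_le_exp (w ^ 2 * x / 2)]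
  have h3 : 1 ≤ exp (w ^ 2 * x / 2) := one_le_exp (by positivity)
  rw [exp_sub, ← mul_div_assoc, div_le_iff₀ (exp_pos _), mul_comm, mul_assoc]
  gcongr
  refine h1.trans ?_
  have h4 : w * x = 2 / w * (w ^ 2 * x / 2) := by field_simp
  have h5 : 2 / w * (w ^ 2 * x / 2) ≤ 2 / w * exp (w ^ 2 * x / 2) := by gcongr
  rw [h4]
  linarith

lemma hasDerivAt_igMoment (hg : Measurable g) (hgl : ∀ x, 0 < x → |g x| ≤ 1 + |log x|)
    {W : ℝ} (hW : 0 < W) :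
    IntegrableOn (fun x ↦ g x * (W * x * (exp (W - W ^ 2 * x / 2) * levyPdf x))) (Ioi 0) ∧
      HasDerivAt (igMoment g) (igMoment g W - igMoment (fun x ↦ g (W ^ 2 * x)⁻¹) W) W := by
  have hint := integrableOn_mul_igDensity hg hgl W
  have key := hasDerivAt_integral_of_dominated_loc_of_deriv_le
    (μ := volume.restrict (Ioi (0 : ℝ))) (x₀ := W) (s := Ioo (W / 2) (2 * W))
    (F := fun w x ↦ g x * (exp (w - w ^ 2 * x / 2) * levyPdf x))
    (F' := fun w x ↦ g x * ((1 - w * x) * (exp (w - w ^ 2 * x / 2) * levyPdf x)))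
    (bound := fun x ↦ exp (2 * W) * (1 + 4 / W) * ((1 + |log x|) * levyPdf x))
    (Ioo_mem_nhds (by linarith) (by linarith))
    (Eventually.of_forall fun w ↦ (integrableOn_mul_igDensity hg hgl w).aestronglyMeasurable)
    hint
    (hg.mul (Measurable.mul (by fun_prop)
      (Measurable.mul (by fun_prop) measurable_levyPdf))).aestronglyMeasurable
    ?_ (integrableOn_one_add_abs_log_mul_levyPdf.const_mul _) ?_
  · obtain ⟨hi, hd⟩ := key
    have heq : (fun x ↦ g x * (W * x * (exp (W - W ^ 2 * x / 2) * levyPdf x))) =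
        fun x ↦ g x * (exp (W - W ^ 2 * x / 2) * levyPdf x) -
          g x * ((1 - W * x) * (exp (W - W ^ 2 * x / 2) * levyPdf x)) := by
      ext x; ring
    have hi' : IntegrableOn (fun x ↦ g x * (W * x * (exp (W - W ^ 2 * x / 2) * levyPdf x)))
        (Ioi 0) := by
      rw [heq]; exact hint.sub hi
    refine ⟨hi', hd.congr_deriv ?_⟩
    rw [← integral_mul_mul_igDensity g hW, igMoment, ← integral_sub hint hi']
    congr 1
    ext x
    ring
  · filter_upwards [ae_restrict_mem measurableSet_Ioi] with x hx w hw
    have hx : 0 < x := hx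
    have hw0 : 0 < w := by linarith [hw.1]
    have h1 := levyPdf_nonneg hx
    have h2 : |1 - w * x| * exp (w - w ^ 2 * x / 2) ≤ exp (2 * W) * (1 + 4 / W) := by
      refine (abs_one_sub_mul_mul_exp_le hw0 hx).trans ?_
      have h3 : 2 / w ≤ 4 / W := by
        rw [div_le_div_iff₀ hw0 hW]; linarith [hw.1]
      have h4 := hw.2.le
      gcongr
    rw [norm_mul, norm_mul, norm_mul, norm_eq_abs, norm_eq_abs, norm_of_nonneg (exp_pos _).le,
      norm_of_nonneg h1]
    calc |g x| * (|1 - w * x| * (exp (w - w ^ 2 * x / 2) * levyPdf x))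
        = |g x| * (|1 - w * x| * exp (w - w ^ 2 * x / 2)) * levyPdf x := by ring
      _ ≤ (1 + |log x|) * (exp (2 * W) * (1 + 4 / W)) * levyPdf x := by
        gcongr
        exact hgl x hx
      _ = _ := by ring
  · refine Eventually.of_forall fun x w _ ↦ ?_
    have h1 : HasDerivAt (fun w : ℝ ↦ w - w ^ 2 * x / 2) (1 - w * x) w := by
      refine ((hasDerivAt_id w).sub (((hasDerivAt_pow 2 w).mul_const x).div_const 2)).congr_deriv ?_
      simp
      ring
    refine ((h1.exp.mul_const (levyPdf x)).const_mul (g x)).congr_deriv ?_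
    ring

lemma tendsto_igMoment_zero (hg : Measurable g) (hgl : ∀ x, 0 < x → |g x| ≤ 1 + |log x|) :
    Tendsto (igMoment g) (𝓝[>] 0) (𝓝 (∫ x in Ioi (0 : ℝ), g x * levyPdf x)) := by
  refine tendsto_integral_filter_of_dominated_convergence
    (fun x ↦ exp 1 * ((1 + |log x|) * levyPdf x))
    (Eventually.of_forall fun w ↦ (integrableOn_mul_igDensity hg hgl w).aestronglyMeasurable)
    ?_ (integrableOn_one_add_abs_log_mul_levyPdf.const_mul _) ?_
  · filter_upwards [Ioo_mem_nhdsGT one_pos] with w hw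
    filter_upwards [ae_restrict_mem measurableSet_Ioi] with x hx
    have hx : 0 < x := hx
    have h1 := levyPdf_nonneg hx
    rw [norm_mul, norm_eq_abs, norm_of_nonneg (by positivity)]
    have h2 : exp (w - w ^ 2 * x / 2) ≤ exp 1 := exp_le_exp.2 (by
      have : 0 ≤ w ^ 2 * x / 2 := by positivity
      linarith [hw.2])
    calc |g x| * (exp (w - w ^ 2 * x / 2) * levyPdf x)
        ≤ (1 + |log x|) * (exp 1 * levyPdf x) := by
          gcongr
          exact hgl x hx
      _ = _ := by ring
  · refine Eventually.of_forall fun x ↦ ?_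
    have : Continuous fun w : ℝ ↦ g x * (exp (w - w ^ 2 * x / 2) * levyPdf x) := by fun_prop
    simpa using (this.tendsto 0).mono_left nhdsWithin_le_nhds

end Moment

lemma igMoment_one {W : ℝ} (hW : 0 < W) : igMoment (fun _ ↦ 1) W = 1 := by
  have hm : Measurable fun _ : ℝ ↦ (1 : ℝ) := measurable_const
  have hl (x : ℝ) (_ : 0 < x) : |(1 : ℝ)| ≤ 1 + |log x| := by simp
  have hd (w : ℝ) (hw : 0 < w) : HasDerivAt (igMoment fun _ ↦ 1) 0 w :=
    (hasDerivAt_igMoment hm hl hw).2.congr_deriv (sub_self _)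
  have hconst : ∀ w ∈ Ioi (0 : ℝ), igMoment (fun _ ↦ 1) w = igMoment (fun _ ↦ 1) W := by
    intro w hw
    exact isOpen_Ioi.is_const_of_deriv_eq_zero isPreconnected_Ioi
      (fun w hw ↦ (hd w hw).differentiableAt.differentiableWithinAt)
      (fun w hw ↦ (hd w hw).deriv) hw hW
  have ht := tendsto_igMoment_zero hm hl
  simp only [one_mul, integral_levyPdf] at ht
  refine tendsto_nhds_unique ?_ ht
  refine tendsto_const_nhds.congr' ?_
  filter_upwards [self_mem_nhdsWithin] with w hw using (hconst w hw).symm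

lemma abs_log_le_one_add (x : ℝ) (_ : 0 < x) : |log x| ≤ 1 + |log x| := by linarith

lemma integral_id_mul_igDensity {W : ℝ} (hW : 0 < W) :
    ∫ x in Ioi (0 : ℝ), W * x * (exp (W - W ^ 2 * x / 2) * levyPdf x) = 1 := by
  simpa [igMoment_one hW] using integral_mul_mul_igDensity (fun _ ↦ 1) hW

lemma integrableOn_igDensity (W : ℝ) :
    IntegrableOn (fun x ↦ exp (W - W ^ 2 * x / 2) * levyPdf x) (Ioi 0) := by
  simpa using integrableOn_mul_igDensity (g := fun _ ↦ 1) measurable_const (by simp) W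

lemma igMoment_log_le {W : ℝ} (hW : 0 < W) : igMoment log W ≤ -log W := by
  have h1 : IntegrableOn (fun x ↦ W * x * (exp (W - W ^ 2 * x / 2) * levyPdf x)) (Ioi 0) := by
    simpa using (hasDerivAt_igMoment (g := fun _ ↦ 1) measurable_const (by simp) hW).1
  have h2 : IntegrableOn (fun x ↦ (1 + log W) * (exp (W - W ^ 2 * x / 2) * levyPdf x)) (Ioi 0) :=
    (integrableOn_igDensity W).const_mul _
  have h3 : igMoment log W ≤ ∫ x in Ioi (0 : ℝ),
      (W * x * (exp (W - W ^ 2 * x / 2) * levyPdf x) -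
        (1 + log W) * (exp (W - W ^ 2 * x / 2) * levyPdf x)) := by
    refine setIntegral_mono_on (integrableOn_mul_igDensity measurable_log abs_log_le_one_add W)
      (h1.sub h2) measurableSet_Ioi fun x (hx : 0 < x) ↦ ?_
    rw [← sub_mul]
    have h4 := levyPdf_nonneg hx
    have h5 := log_le_sub_one_of_pos (mul_pos hW hx)
    rw [log_mul hW.ne' hx.ne'] at h5
    gcongr
    linarith
  have h6 := igMoment_one hW
  simp only [igMoment, one_mul] at h6
  rw [integral_sub h1 h2, integral_const_mul, integral_id_mul_igDensity hW, h6] at h3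
  linarith

/-- The logarithmic moment `F` satisfies `F' = 2 (F + log)`. -/
lemma hasDerivAt_igMoment_log {W : ℝ} (hW : 0 < W) :
    HasDerivAt (igMoment log) (2 * (igMoment log W + log W)) W := by
  refine (hasDerivAt_igMoment measurable_log abs_log_le_one_add hW).2.congr_deriv ?_
  have h1 : igMoment (fun x ↦ log (W ^ 2 * x)⁻¹) W = -(2 * log W) - igMoment log W := by
    have h2 := igMoment_one hW
    simp only [igMoment, one_mul] at h2
    rw [← mul_one (-(2 * log W)), ← h2, ← integral_const_mul, igMoment, igMoment,
      ← integral_sub ((integrableOn_igDensity W).const_mul _)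
        (integrableOn_mul_igDensity measurable_log abs_log_le_one_add W)]
    refine setIntegral_congr_fun measurableSet_Ioi fun x (hx : 0 < x) ↦ ?_
    rw [log_inv, log_mul (by positivity) hx.ne', log_pow]
    push_cast
    ring
  rw [h1]
  ring

lemma igMoment_log_le_cTwo {W : ℝ} (hW : 0 < W) : igMoment log W ≤ cTwo := by
  have hanti : AntitoneOn (igMoment log) (Ioi 0) := by
    refine antitoneOn_of_deriv_nonpos (convex_Ioi 0)
      (fun w hw ↦ (hasDerivAt_igMoment_log hw).continuousAt.continuousWithinAt) ?_ ?_
    · rw [interior_Ioi]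
      exact fun w hw ↦ (hasDerivAt_igMoment_log hw).differentiableAt.differentiableWithinAt
    · rw [interior_Ioi]
      intro w hw
      rw [(hasDerivAt_igMoment_log hw).deriv]
      linarith [igMoment_log_le hw]
  have ht := tendsto_igMoment_zero measurable_log abs_log_le_one_add
  rw [integral_log_mul_levyPdf] at ht
  refine ge_of_tendsto ht ?_
  filter_upwards [Ioo_mem_nhdsGT hW] with w hw using hanti hw.1 hW hw.2.le

lemma neg_mul_exp_le_igMoment_log (W : ℝ) :
    -(∫ x in Ioi (0 : ℝ), (1 + |log x|) * levyPdf x) * exp W ≤ igMoment log W := by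
  rw [neg_mul, ← integral_mul_const, ← integral_neg]
  refine setIntegral_mono_on (integrableOn_one_add_abs_log_mul_levyPdf.mul_const _).neg
    (integrableOn_mul_igDensity measurable_log abs_log_le_one_add W) measurableSet_Ioi
    fun x (hx : 0 < x) ↦ ?_
  have h1 := levyPdf_nonneg hx
  have h2 : exp (W - W ^ 2 * x / 2) ≤ exp W := exp_le_exp.2 (by
    have : 0 ≤ W ^ 2 * x / 2 := by positivity
    linarith)
  have h3 : (1 + |log x|) * (exp (W - W ^ 2 * x / 2) * levyPdf x) ≤
      (1 + |log x|) * (exp W * levyPdf x) := by gcongr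
  have h4 : -(1 + |log x|) * (exp (W - W ^ 2 * x / 2) * levyPdf x) ≤
      log x * (exp (W - W ^ 2 * x / 2) * levyPdf x) := by
    gcongr
    linarith [neg_abs_le (log x)]
  linarith

lemma neg_log_add_half_le_igMoment_log {W : ℝ} (hW : 0 < W) :
    -log (W + 1 / 2) ≤ igMoment log W := by
  set Q : ℝ → ℝ := fun w ↦ exp (-(2 * w)) * (igMoment log w + log (w + 1 / 2)) with hQ
  have hd (w : ℝ) (hw : 0 < w) : HasDerivAt Q
      (exp (-(2 * w)) * (2 * (log w - log (w + 1 / 2)) + (w + 1 / 2)⁻¹)) w := by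
    have h1 : HasDerivAt (fun w : ℝ ↦ exp (-(2 * w))) (exp (-(2 * w)) * (-(2 * 1))) w :=
      ((hasDerivAt_id w).const_mul 2).neg.exp
    have h2 : HasDerivAt (fun w : ℝ ↦ log (w + 1 / 2)) (1 / (w + 1 / 2)) w :=
      ((hasDerivAt_id w).add_const (1 / 2)).log (by simp only [id]; positivity)
    refine (h1.mul ((hasDerivAt_igMoment_log hw).add h2)).congr_deriv ?_
    simp only [Pi.add_apply]
    ring
  have hanti : AntitoneOn Q (Ioi 0) := by
    refine antitoneOn_of_deriv_nonpos (convex_Ioi 0)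
      (fun w hw ↦ (hd w hw).continuousAt.continuousWithinAt) ?_ ?_
    · rw [interior_Ioi]
      exact fun w hw ↦ (hd w hw).differentiableAt.differentiableWithinAt
    · rw [interior_Ioi]
      intro w hw
      have hw : 0 < w := hw
      rw [(hd w hw).deriv]
      refine mul_nonpos_of_nonneg_of_nonpos (exp_pos _).le ?_
      have h1 := log_le_sub_one_of_pos (x := w / (w + 1 / 2)) (by positivity)
      rw [log_div hw.ne' (by positivity)] at h1
      have h2 : w / (w + 1 / 2) - 1 = -((w + 1 / 2)⁻¹ / 2) := by field_simp; ring
      linarith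
  set C := ∫ x in Ioi (0 : ℝ), (1 + |log x|) * levyPdf x
  have hlow : ∀ᶠ w in atTop, -C * exp (-w) ≤ Q W := by
    filter_upwards [eventually_ge_atTop W, eventually_ge_atTop (1 / 2)] with w h1 h2
    refine le_trans ?_ (hanti hW (hW.trans_le h1) h1)
    have h3 := neg_mul_exp_le_igMoment_log w
    have h4 : 0 ≤ log (w + 1 / 2) := log_nonneg (by linarith)
    have h5 : exp (-w) = exp (-(2 * w)) * exp w := by rw [← exp_add]; ring_nf
    calc -C * exp (-w) = exp (-(2 * w)) * (-C * exp w) := by rw [h5]; ring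
      _ ≤ _ := by
        simp only [hQ]
        gcongr
        linarith
  have hlim : Tendsto (fun w ↦ -C * exp (-w)) atTop (𝓝 0) := by
    simpa using (tendsto_exp_neg_atTop_nhds_zero.const_mul (-C))
  have hQW : 0 ≤ Q W := le_of_tendsto hlim hlow
  have := nonneg_of_mul_nonneg_right hQW (exp_pos _)
  linarith

end InverseGaussian

theorem ig_log_moment_bounds (W : ℝ) (hW : 0 < W) :
    -Real.log (W + 1 / 2) ≤ ∫ x in Ioi (0 : ℝ), Real.log x * igPdf W⁻¹ 1 x ∧
    ∫ x in Ioi (0 : ℝ), Real.log x * igPdf W⁻¹ 1 x ≤ min (-Real.log W) cTwo := by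
  have h : ∫ x in Ioi (0 : ℝ), Real.log x * igPdf W⁻¹ 1 x = igMoment Real.log W :=
    setIntegral_congr_fun measurableSet_Ioi fun x hx ↦ by
      simp only [igPdf_inv_one hW hx]
  rw [h]
  exact ⟨neg_log_add_half_le_igMoment_log hW, le_min (igMoment_log_le hW) (igMoment_log_le_cTwo hW)⟩
end

section
/- Let W > 0 and X_W ~ IG(1/W, 1). If 0 < W ≤ (1/2)e^{−γ}, then c₂ + 4W(log W + c₂ − 1) ≤ E[log X_W] ≤ c₂, where c₂ = γ + log 2. In particular, E[log X_W] → c₂ as W → 0. -/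
open MeasureTheory Set Filter

theorem integral_Ioi_comp_div (g : ℝ → ℝ) {b : ℝ} (hb : 0 < b) :
    ∫ t in Ioi (0 : ℝ), b / t ^ 2 * g (b / t) = ∫ t in Ioi (0 : ℝ), g t := by
  have himage : (fun t : ℝ => b / t) '' Ioi 0 = Ioi 0 := by
    ext x
    simp only [mem_image, mem_Ioi]
    constructor
    · rintro ⟨t, ht, rfl⟩
      positivity
    · intro hx
      exact ⟨b / x, by positivity, by field_simp⟩
  have hderiv : ∀ t ∈ Ioi (0 : ℝ),
      HasDerivWithinAt (fun t : ℝ => b / t) (-(b / t ^ 2)) (Ioi 0) t := by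
    intro t ht
    have ht0 : t ≠ 0 := ne_of_gt ht
    refine HasDerivAt.hasDerivWithinAt ?_
    exact ((hasDerivAt_inv ht0).const_mul b).congr_deriv (by field_simp)
  have hinj : InjOn (fun t : ℝ => b / t) (Ioi 0) := by
    intro x hx y hy hxy
    have hx0 : x ≠ 0 := ne_of_gt hx
    have hy0 : y ≠ 0 := ne_of_gt hy
    simp only at hxy
    field_simp at hxy
    exact hxy.symm
  have key := integral_image_eq_integral_abs_deriv_smul measurableSet_Ioi hderiv hinj g
  rw [himage] at key
  rw [key]
  refine setIntegral_congr_fun measurableSet_Ioi fun t ht => ?_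
  have ht0 : (0 : ℝ) < t := ht
  simp only [smul_eq_mul, abs_neg]
  rw [abs_of_pos (by positivity)]

theorem integrableOn_and_hasDerivAt_Gamma_integral {s : ℝ} (hs : 0 < s) :
    IntegrableOn (fun t : ℝ => Real.log t * (t ^ (s - 1) * Real.exp (-t))) (Ioi 0) ∧
      HasDerivAt Real.Gamma
        (∫ t in Ioi (0 : ℝ), Real.log t * (t ^ (s - 1) * Real.exp (-t))) s := by
  have hmellin := mellin_hasDerivAt_of_isBigO_rpow (E := ℂ) (a := s + 1) (b := 0)
    (f := fun t : ℝ => ((Real.exp (-t) : ℝ) : ℂ)) (s := (s : ℂ))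
    ((Continuous.continuousOn (by fun_prop)).locallyIntegrableOn measurableSet_Ioi)
    (by
      rw [← Asymptotics.isBigO_norm_left]
      simp_rw [Complex.norm_real, Asymptotics.isBigO_norm_left]
      simpa only [neg_one_mul] using (isLittleO_exp_neg_mul_rpow_atTop zero_lt_one _).isBigO)
    (by simp)
    (by
      simp_rw [neg_zero, Real.rpow_zero]
      refine Asymptotics.isBigO_const_of_tendsto (y := (1 : ℂ)) ?_ one_ne_zero
      have hc : Continuous fun t : ℝ => ((Real.exp (-t) : ℝ) : ℂ) := by fun_prop
      simpa using (hc.tendsto 0).mono_left nhdsWithin_le_nhds)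
    (by simpa using hs)
  have hcongr : ∀ t ∈ Ioi (0 : ℝ),
      (t : ℂ) ^ ((s : ℂ) - 1) • (Real.log t • ((Real.exp (-t) : ℝ) : ℂ)) =
        ((Real.log t * (t ^ (s - 1) * Real.exp (-t)) : ℝ) : ℂ) := by
    intro t ht
    have ht0 : (0 : ℝ) ≤ t := le_of_lt ht
    rw [show (s : ℂ) - 1 = ((s - 1 : ℝ) : ℂ) by push_cast; ring, ← Complex.ofReal_cpow ht0]
    simp only [smul_eq_mul, Complex.real_smul]
    push_cast
    ring
  obtain ⟨hconv, hderiv⟩ := hmellin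
  have hint_real : IntegrableOn
      (fun t : ℝ => ((Real.log t * (t ^ (s - 1) * Real.exp (-t)) : ℝ) : ℂ)) (Ioi 0) :=
    hconv.congr_fun hcongr measurableSet_Ioi
  refine ⟨?_, ?_⟩
  · have h := hint_real.re
    simpa only [IntegrableOn, RCLike.re_to_complex, Complex.ofReal_re] using h
  · have hval : mellin (fun t : ℝ => Real.log t • ((Real.exp (-t) : ℝ) : ℂ)) (s : ℂ) =
        ((∫ t in Ioi (0 : ℝ), Real.log t * (t ^ (s - 1) * Real.exp (-t)) : ℝ) : ℂ) := by
      rw [mellin, setIntegral_congr_fun measurableSet_Ioi hcongr]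
      exact integral_complex_ofReal
    rw [hval, ← Complex.GammaIntegral_eq_mellin] at hderiv
    have hGamma : HasDerivAt Complex.Gamma
        ((∫ t in Ioi (0 : ℝ), Real.log t * (t ^ (s - 1) * Real.exp (-t)) : ℝ) : ℂ) (s : ℂ) := by
      refine hderiv.congr_of_eventuallyEq ?_
      have hopen : IsOpen {z : ℂ | 0 < z.re} := isOpen_lt continuous_const Complex.continuous_re
      filter_upwards [hopen.mem_nhds (show (s : ℂ) ∈ {z : ℂ | 0 < z.re} by simpa using hs)]
        with z hz using Complex.Gamma_eq_integral hz
    have h := hGamma.real_of_complex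
    simpa only [Complex.ofReal_re, Complex.Gamma_ofReal] using h

theorem gammaEM_eq_eulerMascheroniConstant : gammaEM = Real.eulerMascheroniConstant := by
  have h := (integrableOn_and_hasDerivAt_Gamma_integral one_pos).2.unique
    Real.hasDerivAt_Gamma_one
  rw [gammaEM, ← neg_neg Real.eulerMascheroniConstant, ← h]
  congr 1
  refine integral_congr_ae (Eventually.of_forall fun t => ?_)
  simp [mul_comm]

/-- The density of the Gamma distribution with shape `1 / 2`, up to normalisation. -/
noncomputable def gammaHalfKernel (t : ℝ) : ℝ := Real.exp (-t) / Real.sqrt t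

theorem rpow_half_sub_one_mul_exp_neg {t : ℝ} (ht : 0 < t) :
    t ^ ((1 : ℝ) / 2 - 1) * Real.exp (-t) = gammaHalfKernel t := by
  rw [gammaHalfKernel, show (1 : ℝ) / 2 - 1 = -(1 / 2) by norm_num, Real.rpow_neg ht.le,
    ← Real.sqrt_eq_rpow]
  field_simp

theorem integrableOn_gammaHalfKernel : IntegrableOn gammaHalfKernel (Ioi 0) := by
  refine (Real.GammaIntegral_convergent one_half_pos).congr_fun (fun t ht => ?_) measurableSet_Ioi
  simp only
  rw [mul_comm, rpow_half_sub_one_mul_exp_neg ht]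

theorem integral_gammaHalfKernel :
    ∫ t in Ioi (0 : ℝ), gammaHalfKernel t = Real.sqrt Real.pi := by
  rw [← Real.Gamma_one_half_eq, Real.Gamma_eq_integral one_half_pos]
  refine setIntegral_congr_fun measurableSet_Ioi fun t ht => ?_
  rw [mul_comm (Real.exp (-t)), rpow_half_sub_one_mul_exp_neg ht]

theorem integrableOn_log_mul_gammaHalfKernel :
    IntegrableOn (fun t => Real.log t * gammaHalfKernel t) (Ioi 0) := by
  refine (integrableOn_and_hasDerivAt_Gamma_integral one_half_pos).1.congr_fun (fun t ht => ?_)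
    measurableSet_Ioi
  simp only
  rw [rpow_half_sub_one_mul_exp_neg ht]

theorem integral_log_mul_gammaHalfKernel :
    ∫ t in Ioi (0 : ℝ), Real.log t * gammaHalfKernel t =
      -Real.sqrt Real.pi * (gammaEM + 2 * Real.log 2) := by
  rw [gammaEM_eq_eulerMascheroniConstant, ← (integrableOn_and_hasDerivAt_Gamma_integral
    one_half_pos).2.unique Real.hasDerivAt_Gamma_one_half]
  exact setIntegral_congr_fun measurableSet_Ioi fun t ht => by
    rw [rpow_half_sub_one_mul_exp_neg ht]

theorem continuous_integral_mul_exp_neg_sq_div {φ : ℝ → ℝ} (hφ : IntegrableOn φ (Ioi 0)) :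
    Continuous fun a : ℝ => ∫ t in Ioi (0 : ℝ), φ t * Real.exp (-(a ^ 2 / t)) := by
  refine continuous_of_dominated (bound := fun t => ‖φ t‖) (fun a => ?_) (fun a => ?_) hφ.norm
    (Eventually.of_forall fun t => by fun_prop)
  · exact hφ.aestronglyMeasurable.mul (by fun_prop)
  · filter_upwards [ae_restrict_mem measurableSet_Ioi] with t ht
    have ht0 : (0 : ℝ) < t := ht
    rw [norm_mul, Real.norm_eq_abs (Real.exp _), Real.abs_exp]
    refine mul_le_of_le_one_right (norm_nonneg _) (Real.exp_le_one_iff.2 ?_)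
    exact neg_nonpos.2 (by positivity)

theorem integrableOn_mul_exp_neg_sq_div {φ : ℝ → ℝ} (hφ : IntegrableOn φ (Ioi 0)) (a : ℝ) :
    IntegrableOn (fun t => φ t * Real.exp (-(a ^ 2 / t))) (Ioi 0) := by
  refine Integrable.mono hφ (hφ.aestronglyMeasurable.mul (by fun_prop)) ?_
  filter_upwards [ae_restrict_mem measurableSet_Ioi] with t ht
  have ht0 : (0 : ℝ) < t := ht
  rw [norm_mul, Real.norm_eq_abs (Real.exp _), Real.abs_exp]
  refine mul_le_of_le_one_right (norm_nonneg _) (Real.exp_le_one_iff.2 ?_)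
  exact neg_nonpos.2 (by positivity)

theorem hasDerivAt_integral_mul_exp_neg_sq_div {φ : ℝ → ℝ} (hφ : IntegrableOn φ (Ioi 0))
    {a : ℝ} (ha : 0 < a) :
    HasDerivAt (fun a : ℝ => ∫ t in Ioi (0 : ℝ), φ t * Real.exp (-(a ^ 2 / t)))
      (∫ t in Ioi (0 : ℝ), φ t * (-(2 * a / t) * Real.exp (-(a ^ 2 / t)))) a := by
  refine (hasDerivAt_integral_of_dominated_loc_of_deriv_le
    (μ := volume.restrict (Ioi (0 : ℝ))) (s := Ioi (a / 2))
    (F := fun x t => φ t * Real.exp (-(x ^ 2 / t)))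
    (F' := fun x t => φ t * (-(2 * x / t) * Real.exp (-(x ^ 2 / t))))
    (bound := fun t => ‖φ t‖ * (4 / a))
    (Ioi_mem_nhds (by linarith)) (Eventually.of_forall fun x => ?_)
    (integrableOn_mul_exp_neg_sq_div hφ a) ?_ ?_ (hφ.norm.mul_const _) ?_).2
  · exact hφ.aestronglyMeasurable.mul (by fun_prop)
  · exact hφ.aestronglyMeasurable.mul (by fun_prop)
  · filter_upwards [ae_restrict_mem measurableSet_Ioi] with t ht x hx
    have ht0 : (0 : ℝ) < t := ht
    have hx' : a / 2 < x := hx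
    have hx0 : 0 < x := by linarith
    rw [norm_mul]
    refine mul_le_mul_of_nonneg_left ?_ (norm_nonneg _)
    rw [norm_mul, norm_neg, Real.norm_of_nonneg (by positivity),
      Real.norm_of_nonneg (Real.exp_pos _).le, Real.exp_neg, ← div_eq_mul_inv,
      div_le_iff₀ (Real.exp_pos _)]
    have hexp : x ^ 2 / t ≤ Real.exp (x ^ 2 / t) := by
      linarith [Real.add_one_le_exp (x ^ 2 / t)]
    have h1 : 2 * x / t ≤ 4 / a * (x ^ 2 / t) := by
      rw [div_mul_div_comm, div_le_div_iff₀ ht0 (by positivity)]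
      have : 0 ≤ 2 * x * t * (2 * x - a) := by
        have : 0 ≤ 2 * x - a := by linarith
        positivity
      nlinarith
    exact h1.trans (mul_le_mul_of_nonneg_left hexp (by positivity))
  · refine Eventually.of_forall fun t x _ => ?_
    have h := ((((hasDerivAt_pow 2 x).div_const t).neg).exp).const_mul (φ t)
    refine h.congr_deriv ?_
    simp only [Pi.neg_apply]
    push_cast
    ring

/-- Invariance of the kernel `exp (-t - a² / t) / √t` under `t ↦ a² / t`. -/
theorem integral_gammaHalfKernel_comp_sq_div (g : ℝ → ℝ) {a : ℝ} (ha : 0 < a) :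
    ∫ t in Ioi (0 : ℝ), g t * gammaHalfKernel t * (-(2 * a / t) * Real.exp (-(a ^ 2 / t))) =
      -2 * ∫ t in Ioi (0 : ℝ), g (a ^ 2 / t) * gammaHalfKernel t * Real.exp (-(a ^ 2 / t)) := by
  rw [← integral_Ioi_comp_div _ (pow_pos ha 2), ← integral_const_mul]
  refine setIntegral_congr_fun measurableSet_Ioi fun t ht => ?_
  have ht0 : (0 : ℝ) < t := ht
  have hs : 0 < Real.sqrt t := Real.sqrt_pos.2 ht0
  have hsq : t = Real.sqrt t ^ 2 := (Real.sq_sqrt ht0.le).symm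
  have h1 : a ^ 2 / (a ^ 2 / t) = t := by field_simp
  have h2 : Real.sqrt (a ^ 2 / t) = a / Real.sqrt t := by
    rw [Real.sqrt_div (by positivity), Real.sqrt_sq ha.le]
  simp only [gammaHalfKernel]
  rw [h1, h2]
  generalize Real.exp (-t) = e₁
  generalize Real.exp (-(a ^ 2 / t)) = e₂
  generalize g (a ^ 2 / t) = y
  generalize Real.sqrt t = r at *
  subst hsq
  field_simp

/-- The normalising integral of the kernel `exp (-t - a² / t) / √t`. -/
theorem integral_gammaHalfKernel_mul_exp_neg_sq_div {a : ℝ} (ha : 0 ≤ a) :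
    ∫ t in Ioi (0 : ℝ), gammaHalfKernel t * Real.exp (-(a ^ 2 / t)) =
      Real.sqrt Real.pi * Real.exp (-(2 * a)) := by
  set M : ℝ → ℝ := fun a => ∫ t in Ioi (0 : ℝ), gammaHalfKernel t * Real.exp (-(a ^ 2 / t))
    with hM
  have hMc : Continuous M := continuous_integral_mul_exp_neg_sq_div integrableOn_gammaHalfKernel
  have hM' : ∀ x : ℝ, 0 < x → HasDerivAt M (-2 * M x) x := by
    intro x hx
    have h := hasDerivAt_integral_mul_exp_neg_sq_div integrableOn_gammaHalfKernel hx
    have h1 := integral_gammaHalfKernel_comp_sq_div (fun _ => 1) hx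
    simp only [one_mul] at h1
    rwa [h1] at h
  have hM0 : M 0 = Real.sqrt Real.pi := by
    simp [hM, integral_gammaHalfKernel]
  have hderiv : ∀ x ∈ interior (Icc 0 a),
      HasDerivWithinAt (fun x => M x * Real.exp (2 * x)) 0 (interior (Icc 0 a)) x := by
    intro x hx
    rw [interior_Icc] at hx
    have he : HasDerivAt (fun x : ℝ => Real.exp (2 * x)) (Real.exp (2 * x) * (2 * 1)) x :=
      ((hasDerivAt_id x).const_mul 2).exp
    exact (((hM' x hx.1).mul he).congr_deriv (by ring)).hasDerivWithinAt
  have hcont : ContinuousOn (fun x => M x * Real.exp (2 * x)) (Icc 0 a) :=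
    (hMc.mul (by fun_prop)).continuousOn
  have hconst : M a * Real.exp (2 * a) = M 0 * Real.exp (2 * 0) :=
    le_antisymm
      (antitoneOn_of_hasDerivWithinAt_nonpos (convex_Icc 0 a) hcont hderiv (fun _ _ => le_rfl)
        (left_mem_Icc.2 ha) (right_mem_Icc.2 ha) ha)
      (monotoneOn_of_hasDerivWithinAt_nonneg (convex_Icc 0 a) hcont hderiv (fun _ _ => le_rfl)
        (left_mem_Icc.2 ha) (right_mem_Icc.2 ha) ha)
  rw [mul_zero, Real.exp_zero, mul_one, hM0] at hconst
  rw [Real.exp_neg, ← hconst]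
  field_simp
  rfl

/-- The mean of `log X` for `X` distributed as IG(1 / W, 1), extended continuously to `W = 0`. -/
noncomputable def igLogMoment (W : ℝ) : ℝ :=
  -Real.log 2 - Real.exp W / Real.sqrt Real.pi *
    ∫ t in Ioi (0 : ℝ), Real.log t * gammaHalfKernel t * Real.exp (-((W / 2) ^ 2 / t))

theorem continuous_igLogMoment : Continuous igLogMoment := by
  have h := (continuous_integral_mul_exp_neg_sq_div integrableOn_log_mul_gammaHalfKernel).comp
    (continuous_id.div_const 2)
  exact continuous_const.sub ((Real.continuous_exp.div_const _).mul h)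

theorem igLogMoment_zero : igLogMoment 0 = cTwo := by
  have hpi : Real.sqrt Real.pi ≠ 0 := (Real.sqrt_pos.2 Real.pi_pos).ne'
  simp only [igLogMoment, zero_div, ne_eq, OfNat.ofNat_ne_zero, not_false_eq_true, zero_pow,
    neg_zero, Real.exp_zero, mul_one, integral_log_mul_gammaHalfKernel, cTwo]
  field_simp
  ring

theorem igPdf_half_div {W t : ℝ} (hW : 0 < W) (ht : 0 < t) :
    1 / 2 / t ^ 2 * igPdf W⁻¹ 1 (1 / 2 / t) =
      Real.exp W / Real.sqrt Real.pi *
        (gammaHalfKernel t * Real.exp (-((W / 2) ^ 2 / t))) := by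
  have hs : 0 < Real.sqrt t := Real.sqrt_pos.2 ht
  have hp : 0 < Real.sqrt Real.pi := Real.sqrt_pos.2 Real.pi_pos
  have hsq : Real.sqrt t ^ 2 = t := Real.sq_sqrt ht.le
  have hsqrt : Real.sqrt (1 / (2 * Real.pi * (1 / 2 / t) ^ 3)) =
      2 * t * Real.sqrt t / Real.sqrt Real.pi := by
    rw [Real.sqrt_eq_iff_mul_self_eq_of_pos (by positivity)]
    have : (2 * t * Real.sqrt t / Real.sqrt Real.pi) * (2 * t * Real.sqrt t / Real.sqrt Real.pi) =
        4 * t ^ 2 * Real.sqrt t ^ 2 / Real.sqrt Real.pi ^ 2 := by ring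
    rw [this, hsq, Real.sq_sqrt Real.pi_pos.le]
    have := Real.pi_pos
    field_simp
    norm_num
  have hexp : -(1 * (1 / 2 / t - W⁻¹) ^ 2) / (2 * W⁻¹ ^ 2 * (1 / 2 / t)) =
      W + (-t) + -((W / 2) ^ 2 / t) := by
    field_simp
    ring
  rw [igPdf, hsqrt, hexp, Real.exp_add, Real.exp_add, gammaHalfKernel]
  generalize Real.exp (-((W / 2) ^ 2 / t)) = e
  field_simp
  rw [hsq]

theorem integral_log_mul_igPdf {W : ℝ} (hW : 0 < W) :
    ∫ x in Ioi (0 : ℝ), Real.log x * igPdf W⁻¹ 1 x = igLogMoment W := by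
  have hp : 0 < Real.sqrt Real.pi := Real.sqrt_pos.2 Real.pi_pos
  have hmass := integral_gammaHalfKernel_mul_exp_neg_sq_div (a := W / 2) (by positivity)
  have h1 := integrableOn_mul_exp_neg_sq_div integrableOn_gammaHalfKernel (W / 2)
  have h2 := integrableOn_mul_exp_neg_sq_div integrableOn_log_mul_gammaHalfKernel (W / 2)
  calc ∫ x in Ioi (0 : ℝ), Real.log x * igPdf W⁻¹ 1 x
      = ∫ t in Ioi (0 : ℝ),
          (-(Real.log 2 * (Real.exp W / Real.sqrt Real.pi)) *
            (gammaHalfKernel t * Real.exp (-((W / 2) ^ 2 / t))) -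
          Real.exp W / Real.sqrt Real.pi *
            (Real.log t * gammaHalfKernel t * Real.exp (-((W / 2) ^ 2 / t)))) := by
        rw [← integral_Ioi_comp_div _ (one_half_pos (α := ℝ))]
        refine setIntegral_congr_fun measurableSet_Ioi fun t ht => ?_
        have ht0 : (0 : ℝ) < t := ht
        have hlog : Real.log (1 / 2 / t) = -Real.log 2 - Real.log t := by
          rw [Real.log_div (by norm_num) ht0.ne', one_div, Real.log_inv]
        rw [mul_left_comm, igPdf_half_div hW ht0, hlog]
        ring
    _ = igLogMoment W := by
        rw [integral_sub (h1.const_mul _) (h2.const_mul _), integral_const_mul,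
          integral_const_mul, hmass, igLogMoment, mul_div_cancel₀ W two_ne_zero, Real.exp_neg]
        field_simp

theorem hasDerivAt_igLogMoment {W : ℝ} (hW : 0 < W) :
    HasDerivAt igLogMoment (2 * igLogMoment W + 2 * Real.log W) W := by
  have hp : 0 < Real.sqrt Real.pi := Real.sqrt_pos.2 Real.pi_pos
  have ha : 0 < W / 2 := half_pos hW
  have h1 := integrableOn_mul_exp_neg_sq_div integrableOn_gammaHalfKernel (W / 2)
  have h2 := integrableOn_mul_exp_neg_sq_div integrableOn_log_mul_gammaHalfKernel (W / 2)
  have hsymm : ∫ t in Ioi (0 : ℝ), Real.log t * gammaHalfKernel t *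
        (-(2 * (W / 2) / t) * Real.exp (-((W / 2) ^ 2 / t))) =
      2 * (∫ t in Ioi (0 : ℝ),
        Real.log t * gammaHalfKernel t * Real.exp (-((W / 2) ^ 2 / t))) -
      4 * Real.log (W / 2) * (Real.sqrt Real.pi * Real.exp (-W)) := by
    have hmass := integral_gammaHalfKernel_mul_exp_neg_sq_div ha.le
    rw [mul_div_cancel₀ W two_ne_zero] at hmass
    rw [integral_gammaHalfKernel_comp_sq_div Real.log ha, ← hmass, ← integral_const_mul,
      ← integral_const_mul, ← integral_const_mul,
      ← integral_sub (h2.const_mul _) (h1.const_mul _)]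
    refine setIntegral_congr_fun measurableSet_Ioi fun t ht => ?_
    have ht0 : (0 : ℝ) < t := ht
    have hlog : Real.log ((W / 2) ^ 2 / t) = 2 * Real.log (W / 2) - Real.log t := by
      rw [Real.log_div (by positivity) ht0.ne', Real.log_pow]
      norm_num
    rw [hlog]
    ring
  have hL := hasDerivAt_integral_mul_exp_neg_sq_div integrableOn_log_mul_gammaHalfKernel ha
  rw [hsymm] at hL
  have hcomp := hL.comp W ((hasDerivAt_id W).div_const 2)
  have h := (((Real.hasDerivAt_exp W).div_const (Real.sqrt Real.pi)).mul hcomp).const_sub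
    (-Real.log 2)
  refine h.congr_deriv ?_
  simp only [Function.comp_apply, id_eq, igLogMoment]
  generalize (∫ t in Ioi (0 : ℝ),
    Real.log t * gammaHalfKernel t * Real.exp (-((W / 2) ^ 2 / t))) = L
  rw [Real.log_div hW.ne' two_ne_zero, Real.exp_neg]
  field_simp
  ring

theorem hasDerivAt_exp_mul_igLogMoment_sub {W : ℝ} (hW : 0 < W) :
    HasDerivAt (fun x => Real.exp (-(2 * x)) * (igLogMoment x - cTwo))
      (2 * Real.exp (-(2 * W)) * (Real.log W + cTwo)) W := by
  have he : HasDerivAt (fun x : ℝ => Real.exp (-(2 * x))) (Real.exp (-(2 * W)) * -(2 * 1)) W :=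
    (((hasDerivAt_id W).const_mul 2).neg).exp
  refine (he.mul ((hasDerivAt_igLogMoment hW).sub_const cTwo)).congr_deriv ?_
  ring

theorem log_add_cTwo_nonpos {W : ℝ} (hW : 0 < W) (hW' : W ≤ 1 / 2 * Real.exp (-gammaEM)) :
    Real.log W + cTwo ≤ 0 := by
  have h := Real.log_le_log hW hW'
  rw [Real.log_mul (by norm_num) (Real.exp_pos _).ne', Real.log_exp, one_div, Real.log_inv] at h
  rw [cTwo]
  linarith

theorem exp_two_mul_le_two {W : ℝ} (hW' : W ≤ 1 / 2 * Real.exp (-gammaEM)) :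
    Real.exp (2 * W) ≤ 2 := by
  have hγ : 1 / 2 < gammaEM := by
    rw [gammaEM_eq_eulerMascheroniConstant]
    exact Real.one_half_lt_eulerMascheroniConstant
  have hexp : Real.exp (-gammaEM) ≤ 2 / 3 := by
    have h1 : 3 / 2 ≤ Real.exp gammaEM := by linarith [Real.add_one_le_exp gammaEM]
    rw [Real.exp_neg, inv_le_comm₀ (Real.exp_pos _) (by norm_num)]
    linarith
  rw [← Real.le_log_iff_exp_le two_pos]
  linarith [Real.log_two_gt_d9]

theorem igLogMoment_le {W : ℝ} (hW : 0 < W) (hW' : W ≤ 1 / 2 * Real.exp (-gammaEM)) :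
    igLogMoment W ≤ cTwo := by
  have hanti : AntitoneOn (fun x => Real.exp (-(2 * x)) * (igLogMoment x - cTwo)) (Icc 0 W) := by
    refine antitoneOn_of_hasDerivWithinAt_nonpos (convex_Icc 0 W)
      (Continuous.continuousOn ?_)
      (f' := fun x => 2 * Real.exp (-(2 * x)) * (Real.log x + cTwo)) ?_ ?_
    · exact (by fun_prop : Continuous fun x : ℝ => Real.exp (-(2 * x))).mul
        (continuous_igLogMoment.sub continuous_const)
    · intro x hx
      rw [interior_Icc] at hx
      exact (hasDerivAt_exp_mul_igLogMoment_sub hx.1).hasDerivWithinAt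
    · intro x hx
      rw [interior_Icc] at hx
      exact mul_nonpos_of_nonneg_of_nonpos (by positivity)
        (log_add_cTwo_nonpos hx.1 (hx.2.le.trans hW'))
  have h := hanti (left_mem_Icc.2 hW.le) (right_mem_Icc.2 hW.le) hW.le
  simp only [igLogMoment_zero, sub_self, mul_zero] at h
  have := nonpos_of_mul_nonpos_right h (Real.exp_pos _)
  linarith

theorem le_igLogMoment {W : ℝ} (hW : 0 < W) (hW' : W ≤ 1 / 2 * Real.exp (-gammaEM)) :
    cTwo + 4 * W * (Real.log W + cTwo - 1) ≤ igLogMoment W := by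
  have hmono : MonotoneOn (fun x => Real.exp (-(2 * x)) * (igLogMoment x - cTwo) -
      2 * (x * Real.log x + (cTwo - 1) * x)) (Icc 0 W) := by
    refine monotoneOn_of_hasDerivWithinAt_nonneg (convex_Icc 0 W)
      (Continuous.continuousOn ?_)
      (f' := fun x => 2 * Real.exp (-(2 * x)) * (Real.log x + cTwo) -
        2 * (Real.log x + 1 + (cTwo - 1) * 1)) ?_ ?_
    · refine Continuous.sub ((by fun_prop : Continuous fun x : ℝ => Real.exp (-(2 * x))).mul
        (continuous_igLogMoment.sub continuous_const)) ?_
      exact continuous_const.mul (Real.continuous_mul_log.add (by fun_prop))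
    · intro x hx
      rw [interior_Icc] at hx
      exact ((hasDerivAt_exp_mul_igLogMoment_sub hx.1).sub
        (((Real.hasDerivAt_mul_log hx.1.ne').add
          ((hasDerivAt_id x).const_mul (cTwo - 1))).const_mul 2)).hasDerivWithinAt
    · intro x hx
      rw [interior_Icc] at hx
      have h1 := log_add_cTwo_nonpos hx.1 (hx.2.le.trans hW')
      have h2 : Real.exp (-(2 * x)) ≤ 1 := Real.exp_le_one_iff.2 (by linarith [hx.1])
      nlinarith [mul_nonneg (sub_nonneg.2 h2) (neg_nonneg.2 h1)]
  have h := hmono (left_mem_Icc.2 hW.le) (right_mem_Icc.2 hW.le) hW.le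
  simp only [igLogMoment_zero, sub_self, mul_zero, zero_mul, add_zero] at h
  have hB : W * (Real.log W + cTwo - 1) ≤ 0 :=
    mul_nonpos_of_nonneg_of_nonpos hW.le (by linarith [log_add_cTwo_nonpos hW hW'])
  have hE : Real.exp (2 * W) * Real.exp (-(2 * W)) = 1 := by
    rw [← Real.exp_add, add_neg_cancel, Real.exp_zero]
  have hlow : 2 * (W * (Real.log W + cTwo - 1)) ≤
      Real.exp (-(2 * W)) * (igLogMoment W - cTwo) := by linarith
  have hmul := mul_le_mul_of_nonneg_left hlow (Real.exp_pos (2 * W)).le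
  rw [← mul_assoc _ (Real.exp (-(2 * W))), hE, one_mul] at hmul
  nlinarith [mul_nonneg (sub_nonneg.2 (exp_two_mul_le_two hW')) (neg_nonneg.2 hB)]

theorem ig_log_moment_small_W :
    (∀ W : ℝ, 0 < W → W ≤ (1 / 2) * Real.exp (-gammaEM) →
      cTwo + 4 * W * (Real.log W + cTwo - 1)
          ≤ ∫ x in Ioi (0 : ℝ), Real.log x * igPdf W⁻¹ 1 x ∧
      ∫ x in Ioi (0 : ℝ), Real.log x * igPdf W⁻¹ 1 x ≤ cTwo) ∧
    Tendsto (fun W : ℝ => ∫ x in Ioi (0 : ℝ), Real.log x * igPdf W⁻¹ 1 x)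
      (nhdsWithin 0 (Ioi 0)) (nhds cTwo) := by
  refine ⟨fun W hW hW' => ?_, ?_⟩
  · rw [integral_log_mul_igPdf hW]
    exact ⟨le_igLogMoment hW hW', igLogMoment_le hW hW'⟩
  · have h : Tendsto igLogMoment (nhdsWithin 0 (Ioi 0)) (nhds cTwo) := by
      rw [← igLogMoment_zero]
      exact (continuous_igLogMoment.tendsto 0).mono_left nhdsWithin_le_nhds
    refine h.congr' ?_
    filter_upwards [self_mem_nhdsWithin] with W hW using (integral_log_mul_igPdf hW).symm
end
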